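/- (Case 1 of the monotonicity proof.) Let n, k ∈ ℕ with n ≥ 1, let a ∈ {0,1,…,n−1}^k, let u, v ∈ {0,1,…,n−1}^k with u ≤ v componentwise, and let i ∈ {1,…,k}. If u_i < a_i and u_j ≥ a_j for all j < i (so that f^a_i(u) = u_i + 1), then f^a_i(v) ≥ u_i + 1, i.e. f^a_i(v) ≥ f^a_i(u). -/

import Mathlib

/-- The function `f^a` from Definition 2 of the paper, defined coordinatewise:
`f^a_i(v) = v_i - 1` if `v_i > a_i` and `v_j ≤ a_j` for all `j < i`;
`f^a_i(v) = v_i + 1` if `v_i < a_i` and `v_j ≥ a_j` for all `j < i`;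
`f^a_i(v) = v_i` otherwise. -/
def tarskiF {k : ℕ} (a v : Fin k → ℕ) : Fin k → ℕ := fun i =>
  if a i < v i ∧ ∀ j, j < i → v j ≤ a j then v i - 1
  else if v i < a i ∧ ∀ j, j < i → a j ≤ v j then v i + 1
  else v i

/-- Case 1 of the monotonicity proof: if `u_i < a_i` and `u_j ≥ a_j` for all `j < i`
(so `f^a_i(u) = u_i + 1`), then `f^a_i(v) ≥ u_i + 1 = f^a_i(u)`. -/
theorem tarskiF_monotone_case1 (n k : ℕ) (hn : 1 ≤ n)
    (a : Fin k → ℕ) (ha : ∀ i, a i < n)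
    (u v : Fin k → ℕ) (hu : ∀ i, u i < n) (hv : ∀ i, v i < n)
    (huv : u ≤ v) (i : Fin k)
    (h1 : u i < a i) (h2 : ∀ j, j < i → a j ≤ u j) :
    u i + 1 ≤ tarskiF a v i ∧ tarskiF a u i ≤ tarskiF a v i := by
  have hle : u i ≤ v i := huv i
  have h3 : ∀ j, j < i → a j ≤ v j := fun j hj => (h2 j hj).trans (huv j)
  have hU : tarskiF a u i = u i + 1 := by
    unfold tarskiF
    rw [if_neg (fun h => absurd h.1 (by omega)), if_pos ⟨h1, h2⟩]
  have hV : u i + 1 ≤ tarskiF a v i := by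
    unfold tarskiF
    split_ifs with c d
    · have := c.1
      omega
    · omega
    · have : ¬ v i < a i := fun h => d ⟨h, h3⟩
      omega
  exact ⟨hV, hU ▸ hV⟩
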